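/- Every global maximizer S of f over St(d,p)^{⊗n} satisfies d_F(S,Z) ≤ 4√(d/n)·‖Δ‖_op. -/

import Mathlib

open Matrix MeasureTheory ProbabilityTheory
open scoped BigOperators ENNReal

noncomputable section

/-- Frobenius inner product `⟨X, Y⟩ = Tr (X Yᵀ)`. -/
def finner {m k : Type*} [Fintype m] [Fintype k] (X Y : Matrix m k ℝ) : ℝ :=
  ∑ i, ∑ j, X i j * Y i j

/-- Frobenius norm. -/
def frobNorm {m k : Type*} [Fintype m] [Fintype k] (X : Matrix m k ℝ) : ℝ :=
  Real.sqrt (∑ i, ∑ j, (X i j) ^ 2)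

/-- Spectral (ℓ²-operator) norm of a real matrix. -/
def opNorm {m k : Type*} [Fintype m] [Fintype k] [DecidableEq k] (X : Matrix m k ℝ) : ℝ :=
  ‖LinearMap.toContinuousLinearMap (Matrix.toEuclideanLin X)‖

/-- The `(i,j)` d×d block of an (nd)×(nd) matrix. -/
def blk {n d : ℕ} (M : Matrix (Fin n × Fin d) (Fin n × Fin d) ℝ) (i j : Fin n) :
    Matrix (Fin d) (Fin d) ℝ := fun k l => M (i, k) (j, l)

/-- The i-th d×p block row of an (nd)×p matrix. -/
def rowBlk {n d p : ℕ} (S : Matrix (Fin n × Fin d) (Fin p) ℝ) (i : Fin n) :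
    Matrix (Fin d) (Fin p) ℝ := fun k l => S (i, k) l

/-- The i-th (nd)×d block column of an (nd)×(nd) matrix. -/
def colBlk {n d : ℕ} (M : Matrix (Fin n × Fin d) (Fin n × Fin d) ℝ) (i : Fin n) :
    Matrix (Fin n × Fin d) (Fin d) ℝ := fun q l => M q (i, l)

/-- All d×p block rows lie in the Stiefel manifold St(d,p) (for p = d: are orthogonal). -/
def StiefelBlocks {n d p : ℕ} (S : Matrix (Fin n × Fin d) (Fin p) ℝ) : Prop :=
  ∀ i, rowBlk S i * (rowBlk S i)ᵀ = 1

/-- The vertical stack Z of n copies of the identity I_d. -/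
def Zmat (n d : ℕ) : Matrix (Fin n × Fin d) (Fin d) ℝ := fun q l => if q.2 = l then 1 else 0

/-- Feasibility for the SDP relaxation: symmetric, PSD, identity diagonal blocks. -/
def sdpFeasible {n d : ℕ} (X : Matrix (Fin n × Fin d) (Fin n × Fin d) ℝ) : Prop :=
  X.IsSymm ∧ X.PosSemidef ∧ ∀ i, blk X i i = 1

/-- Global maximizer of the SDP relaxation with data `A`. -/
def sdpMaximizer {n d : ℕ} (A X : Matrix (Fin n × Fin d) (Fin n × Fin d) ℝ) : Prop :=
  sdpFeasible X ∧ ∀ Y, sdpFeasible Y → finner A Y ≤ finner A X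

/-- Global maximizer of the program (P) with data `A`. -/
def progPMaximizer {n d : ℕ} (A : Matrix (Fin n × Fin d) (Fin n × Fin d) ℝ)
    (R : Matrix (Fin n × Fin d) (Fin d) ℝ) : Prop :=
  StiefelBlocks R ∧
    ∀ R' : Matrix (Fin n × Fin d) (Fin d) ℝ, StiefelBlocks R' →
      finner A (R' * R'ᵀ) ≤ finner A (R * Rᵀ)

/-- The distance `d_F(S, Z) = min_{Q ∈ St(d,p)} ‖S − ZQ‖_F`. -/
def dF {n d p : ℕ} (S : Matrix (Fin n × Fin d) (Fin p) ℝ) : ℝ :=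
  sInf {c | ∃ Q : Matrix (Fin d) (Fin p) ℝ, Q * Qᵀ = 1 ∧ c = frobNorm (S - Zmat n d * Q)}

/-- `Λ_{ii}(S) = (1/2) Σ_j (S_i S_jᵀ A_{ji} + A_{ij} S_j S_iᵀ)`. -/
def Lam {n d p : ℕ} (A : Matrix (Fin n × Fin d) (Fin n × Fin d) ℝ)
    (S : Matrix (Fin n × Fin d) (Fin p) ℝ) (i : Fin n) : Matrix (Fin d) (Fin d) ℝ :=
  (1 / 2 : ℝ) •
    ∑ j, (rowBlk S i * (rowBlk S j)ᵀ * blk A j i + blk A i j * rowBlk S j * (rowBlk S i)ᵀ)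

/-- Block diagonal matrix with given d×d diagonal blocks. -/
def blkDiag {n d : ℕ} (D : Fin n → Matrix (Fin d) (Fin d) ℝ) :
    Matrix (Fin n × Fin d) (Fin n × Fin d) ℝ :=
  fun q r => if q.1 = r.1 then D q.1 q.2 r.2 else 0

/-- Local maximizer of `f(S) = ⟨A, S Sᵀ⟩` over `St(d,p)^{⊗n}`. -/
def isLocalMax {n d p : ℕ} (A : Matrix (Fin n × Fin d) (Fin n × Fin d) ℝ)
    (S : Matrix (Fin n × Fin d) (Fin p) ℝ) : Prop :=
  StiefelBlocks S ∧ ∃ ε > (0 : ℝ), ∀ S' : Matrix (Fin n × Fin d) (Fin p) ℝ,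
    StiefelBlocks S' → frobNorm (S' - S) < ε → finner A (S' * S'ᵀ) ≤ finner A (S * Sᵀ)

/-- First-order criticality: `Σ_j A_{ij} S_j = Λ_{ii}(S) S_i` for all i. -/
def firstOrderCrit {n d p : ℕ} (A : Matrix (Fin n × Fin d) (Fin n × Fin d) ℝ)
    (S : Matrix (Fin n × Fin d) (Fin p) ℝ) : Prop :=
  ∀ i, (∑ j, blk A i j * rowBlk S j) = Lam A S i * rowBlk S i

/-- Second-order necessary inequality over tangent directions. -/
def secondOrderIneq {n d p : ℕ} (A : Matrix (Fin n × Fin d) (Fin n × Fin d) ℝ)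
    (S : Matrix (Fin n × Fin d) (Fin p) ℝ) : Prop :=
  ∀ Y : Matrix (Fin n × Fin d) (Fin p) ℝ,
    (∀ i, rowBlk S i * (rowBlk Y i)ᵀ + rowBlk Y i * (rowBlk S i)ᵀ = 0) →
    ∑ i, ∑ j, finner (blk A i j) (rowBlk Y i * (rowBlk Y j)ᵀ) ≤
      ∑ i, finner (Lam A S i) (rowBlk Y i * (rowBlk Y i)ᵀ)

/-- Second-order critical point of `f`. -/
def secondOrderCrit {n d p : ℕ} (A : Matrix (Fin n × Fin d) (Fin n × Fin d) ℝ)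
    (S : Matrix (Fin n × Fin d) (Fin p) ℝ) : Prop :=
  StiefelBlocks S ∧ firstOrderCrit A S ∧ secondOrderIneq A S

/-- Partial trace `Tr_d(Δ) ∈ ℝ^{n×n}`. -/
def partialTrace {n d : ℕ} (Δ : Matrix (Fin n × Fin d) (Fin n × Fin d) ℝ) :
    Matrix (Fin n) (Fin n) ℝ := fun i j => (blk Δ i j).trace

/-- Singular values of a d×p real matrix (square roots of the eigenvalues of `M Mᴴ`). -/
def singVals {d p : ℕ} (M : Matrix (Fin d) (Fin p) ℝ) (i : Fin d) : ℝ :=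
  Real.sqrt ((Matrix.isHermitian_mul_conjTranspose_self M).eigenvalues i)

/-- Nuclear norm: sum of singular values. -/
def nuclearNorm {d p : ℕ} (M : Matrix (Fin d) (Fin p) ℝ) : ℝ :=
  ∑ i, singVals M i

/-- The law of the iid standard Gaussian coordinates indexing the noise. -/
def gaussianEnsemble (n d : ℕ) :
    Measure (((Fin n × Fin d) × (Fin n × Fin d)) → ℝ) :=
  Measure.pi fun _ => gaussianReal 0 1

/-- The symmetric Gaussian random matrix `W` built from the iid coordinates:
`W_{ii} = 0`, the entries of `W_{ij}` for `i < j` are iid standard Gaussians, and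
`W_{ji} = W_{ij}ᵀ`. -/
def Wof {n d : ℕ} (ω : ((Fin n × Fin d) × (Fin n × Fin d)) → ℝ) :
    Matrix (Fin n × Fin d) (Fin n × Fin d) ℝ :=
  fun q r => if q.1 < r.1 then ω (q, r) else if r.1 < q.1 then ω (r, q) else 0

theorem finner_eq_trace {m k : Type*} [Fintype m] [Fintype k] (X Y : Matrix m k ℝ) :
    finner X Y = (X * Yᵀ).trace := by
  simp [finner, Matrix.trace, Matrix.mul_apply]

theorem finner_comm {m k : Type*} [Fintype m] [Fintype k] (X Y : Matrix m k ℝ) :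
    finner X Y = finner Y X := by
  simp only [finner, mul_comm]

theorem finner_add_left {m k : Type*} [Fintype m] [Fintype k] (X Y W : Matrix m k ℝ) :
    finner (X + Y) W = finner X W + finner Y W := by
  simp [finner_eq_trace, Matrix.add_mul]

theorem finner_sub_left {m k : Type*} [Fintype m] [Fintype k] (X Y W : Matrix m k ℝ) :
    finner (X - Y) W = finner X W - finner Y W := by
  simp [finner_eq_trace, Matrix.sub_mul]

theorem finner_add_right {m k : Type*} [Fintype m] [Fintype k] (X Y W : Matrix m k ℝ) :
    finner W (X + Y) = finner W X + finner W Y := by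
  simp [finner_eq_trace, Matrix.mul_add]

theorem finner_sub_right {m k : Type*} [Fintype m] [Fintype k] (X Y W : Matrix m k ℝ) :
    finner W (X - Y) = finner W X - finner W Y := by
  simp [finner_eq_trace, Matrix.mul_sub]

theorem finner_smul_left {m k : Type*} [Fintype m] [Fintype k] (c : ℝ) (X Y : Matrix m k ℝ) :
    finner (c • X) Y = c * finner X Y := by
  simp [finner_eq_trace]

theorem finner_sum_left {ι m k : Type*} [Fintype m] [Fintype k] (s : Finset ι)
    (X : ι → Matrix m k ℝ) (Y : Matrix m k ℝ) :
    finner (∑ i ∈ s, X i) Y = ∑ i ∈ s, finner (X i) Y := by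
  simp only [finner_eq_trace, Matrix.sum_mul, Matrix.trace_sum]

theorem finner_mul_left {m k l : Type*} [Fintype m] [Fintype k] [Fintype l]
    (X : Matrix m l ℝ) (U : Matrix l k ℝ) (V : Matrix m k ℝ) :
    finner (X * U) V = finner U (Xᵀ * V) := by
  rw [finner_eq_trace, finner_eq_trace, Matrix.transpose_mul, Matrix.transpose_transpose,
    Matrix.mul_assoc, Matrix.trace_mul_comm, Matrix.mul_assoc]

theorem finner_mul_transpose_right {m k l : Type*} [Fintype m] [Fintype k] [Fintype l]
    (X : Matrix m l ℝ) (U : Matrix l k ℝ) (V : Matrix m k ℝ) :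
    finner X (V * Uᵀ) = finner (X * U) V := by
  rw [finner_eq_trace, finner_eq_trace, Matrix.transpose_mul, Matrix.transpose_transpose,
    Matrix.mul_assoc]

theorem sq_frobNorm {m k : Type*} [Fintype m] [Fintype k] (X : Matrix m k ℝ) :
    frobNorm X ^ 2 = finner X X := by
  rw [frobNorm, Real.sq_sqrt (by positivity)]
  simp [finner, sq]

theorem frobNorm_nonneg {m k : Type*} [Fintype m] [Fintype k] (X : Matrix m k ℝ) :
    0 ≤ frobNorm X := Real.sqrt_nonneg _

theorem opNorm_nonneg {m k : Type*} [Fintype m] [Fintype k] [DecidableEq k] (X : Matrix m k ℝ) :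
    0 ≤ opNorm X := norm_nonneg _

theorem dotProduct_mulVec_le_opNorm {m k : Type*} [Fintype m] [Fintype k] [DecidableEq k]
    (X : Matrix m k ℝ) (u : k → ℝ) (v : m → ℝ) :
    (X *ᵥ u) ⬝ᵥ v ≤ opNorm X * (√(∑ i, u i ^ 2) * √(∑ i, v i ^ 2)) := by
  have hinner : (X *ᵥ u) ⬝ᵥ v
      = inner ℝ (WithLp.toLp 2 v) (Matrix.toEuclideanLin X (WithLp.toLp 2 u)) := by
    simp [Matrix.toEuclideanLin, EuclideanSpace.inner_eq_star_dotProduct]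
  have hu : √(∑ i, u i ^ 2) = ‖(WithLp.toLp 2 u : EuclideanSpace ℝ k)‖ := by
    simp [EuclideanSpace.norm_eq]
  have hv : √(∑ i, v i ^ 2) = ‖(WithLp.toLp 2 v : EuclideanSpace ℝ m)‖ := by
    simp [EuclideanSpace.norm_eq]
  rw [hinner, hu, hv]
  have hop := (LinearMap.toContinuousLinearMap (Matrix.toEuclideanLin X)).le_opNorm
    (WithLp.toLp 2 u)
  calc _ ≤ ‖(WithLp.toLp 2 v : EuclideanSpace ℝ m)‖
        * ‖Matrix.toEuclideanLin X (WithLp.toLp 2 u)‖ := real_inner_le_norm _ _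
    _ ≤ ‖(WithLp.toLp 2 v : EuclideanSpace ℝ m)‖
        * (opNorm X * ‖(WithLp.toLp 2 u : EuclideanSpace ℝ k)‖) := by
      gcongr
      exact hop
    _ = _ := by ring

theorem finner_mul_le_opNorm {m k l : Type*} [Fintype m] [Fintype k] [Fintype l] [DecidableEq l]
    (X : Matrix m l ℝ) (U : Matrix l k ℝ) (V : Matrix m k ℝ) :
    finner (X * U) V ≤ opNorm X * (frobNorm U * frobNorm V) := by
  have hcols : finner (X * U) V = ∑ j, (X *ᵥ fun i => U i j) ⬝ᵥ fun i => V i j := by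
    rw [finner, Finset.sum_comm]
    rfl
  have hU : frobNorm U = √(∑ j, √(∑ i, U i j ^ 2) ^ 2) := by
    rw [frobNorm, Finset.sum_comm]
    congr 1
    exact Finset.sum_congr rfl fun j _ => (Real.sq_sqrt (by positivity)).symm
  have hV : frobNorm V = √(∑ j, √(∑ i, V i j ^ 2) ^ 2) := by
    rw [frobNorm, Finset.sum_comm]
    congr 1
    exact Finset.sum_congr rfl fun j _ => (Real.sq_sqrt (by positivity)).symm
  rw [hcols]
  calc _ ≤ ∑ j, opNorm X * (√(∑ i, U i j ^ 2) * √(∑ i, V i j ^ 2)) :=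
        Finset.sum_le_sum fun j _ => dotProduct_mulVec_le_opNorm X _ _
    _ = opNorm X * ∑ j, √(∑ i, U i j ^ 2) * √(∑ i, V i j ^ 2) := by rw [Finset.mul_sum]
    _ ≤ _ := by
      rw [hU, hV]
      exact mul_le_mul_of_nonneg_left (Real.sum_mul_le_sqrt_mul_sqrt _ _ _) (opNorm_nonneg X)

theorem finner_eq_sum_rowBlk {n d p : ℕ} (S T : Matrix (Fin n × Fin d) (Fin p) ℝ) :
    finner S T = ∑ i, finner (rowBlk S i) (rowBlk T i) := by
  simp only [finner, Fintype.sum_prod_type, rowBlk]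

theorem finner_self_of_mul_transpose_eq_one {d p : ℕ} {Q : Matrix (Fin d) (Fin p) ℝ}
    (hQ : Q * Qᵀ = 1) : finner Q Q = d := by
  simp [finner_eq_trace, hQ]

theorem StiefelBlocks.finner_self {n d p : ℕ} {S : Matrix (Fin n × Fin d) (Fin p) ℝ}
    (hS : StiefelBlocks S) : finner S S = n * d := by
  rw [finner_eq_sum_rowBlk,
    Finset.sum_congr rfl fun i _ => finner_self_of_mul_transpose_eq_one (hS i)]
  simp

theorem rowBlk_Zmat_mul {n d p : ℕ} (Q : Matrix (Fin d) (Fin p) ℝ) (i : Fin n) :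
    rowBlk (Zmat n d * Q) i = Q := by
  ext k l
  simp [rowBlk, Zmat, Matrix.mul_apply]

theorem Zmat_transpose_mul {n d p : ℕ} (S : Matrix (Fin n × Fin d) (Fin p) ℝ) :
    (Zmat n d)ᵀ * S = ∑ i, rowBlk S i := by
  ext k l
  simp [rowBlk, Zmat, Matrix.mul_apply, Matrix.sum_apply, Fintype.sum_prod_type]

theorem dF_le {n d p : ℕ} (S : Matrix (Fin n × Fin d) (Fin p) ℝ) {Q : Matrix (Fin d) (Fin p) ℝ}
    (hQ : Q * Qᵀ = 1) : dF S ≤ frobNorm (S - Zmat n d * Q) := by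
  refine csInf_le ⟨0, ?_⟩ ⟨Q, hQ, rfl⟩
  rintro c ⟨Q', -, rfl⟩
  exact frobNorm_nonneg _

/-- Some block row of `S` correlates with `ZᵀS`, the sum of all blocks, at least as well as
their average does. -/
theorem exists_rowBlk_finner_ge {n d p : ℕ} (hn : 0 < n)
    (S : Matrix (Fin n × Fin d) (Fin p) ℝ) :
    ∃ i, finner ((Zmat n d)ᵀ * S) ((Zmat n d)ᵀ * S)
      ≤ n * finner (rowBlk S i) ((Zmat n d)ᵀ * S) := by
  have : Nonempty (Fin n) := ⟨⟨0, hn⟩⟩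
  set M := (Zmat n d)ᵀ * S with hM
  obtain ⟨i, hi⟩ := Finite.exists_max fun i => finner (rowBlk S i) M
  refine ⟨i, ?_⟩
  calc finner M M = ∑ j, finner (rowBlk S j) M := by
        rw [← finner_sum_left, ← Zmat_transpose_mul]
    _ ≤ ∑ _j : Fin n, finner (rowBlk S i) M := Finset.sum_le_sum fun j _ => hi j
    _ = n * finner (rowBlk S i) M := by simp

/-- proximity condition for global maximizers of `f` (Proposition 5.8). -/
theorem global_max_proximity {n d p : ℕ} (hn : 2 ≤ n) (hd : 1 ≤ d) (hp : d ≤ p)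
    (Δ : Matrix (Fin n × Fin d) (Fin n × Fin d) ℝ)
    (hΔsym : Δ.IsSymm) (hΔdiag : ∀ i, blk Δ i i = 0)
    (A : Matrix (Fin n × Fin d) (Fin n × Fin d) ℝ)
    (hA : A = Zmat n d * (Zmat n d)ᵀ + Δ)
    (S : Matrix (Fin n × Fin d) (Fin p) ℝ) (hS : StiefelBlocks S)
    (hmax : ∀ S' : Matrix (Fin n × Fin d) (Fin p) ℝ, StiefelBlocks S' →
      finner A (S' * S'ᵀ) ≤ finner A (S * Sᵀ)) :
    dF S ≤ 4 * Real.sqrt ((d : ℝ) / n) * opNorm Δ := by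
  have hn0 : (0 : ℝ) < n := by exact_mod_cast (by omega : 0 < n)
  obtain ⟨i, hi⟩ := exists_rowBlk_finner_ge (by omega) S
  have hQ := hS i
  set Q := rowBlk S i
  set T := Zmat n d * Q with hT
  have hTS : StiefelBlocks T := fun j => by rw [hT, rowBlk_Zmat_mul, hQ]
  have hSS := hS.finner_self
  have hTT := hTS.finner_self
  have hST : finner S T = finner Q ((Zmat n d)ᵀ * S) := by
    rw [finner_comm, hT, finner_mul_left]
  have hexpand : ∀ R : Matrix (Fin n × Fin d) (Fin p) ℝ,
      finner A (R * Rᵀ) = finner ((Zmat n d)ᵀ * R) ((Zmat n d)ᵀ * R) + finner (Δ * R) R := by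
    intro R
    rw [finner_mul_transpose_right, hA, Matrix.add_mul, finner_add_left, Matrix.mul_assoc,
      finner_mul_left (Zmat n d)]
  have hZT : finner ((Zmat n d)ᵀ * T) ((Zmat n d)ᵀ * T) = n * (n * d) := by
    have hsum : (Zmat n d)ᵀ * T = (n : ℝ) • Q := by
      rw [Zmat_transpose_mul, Finset.sum_congr rfl fun j _ => rowBlk_Zmat_mul Q j]
      simp [← Nat.cast_smul_eq_nsmul ℝ]
    rw [hsum, finner_smul_left, finner_comm, finner_smul_left,
      finner_self_of_mul_transpose_eq_one hQ]
  have hsymm : finner (Δ * S) T = finner (Δ * T) S := by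
    rw [finner_mul_left, hΔsym.eq, finner_comm]
  have hcross : finner (Δ * (S + T)) (S - T) = finner (Δ * S) S - finner (Δ * T) T := by
    rw [Matrix.mul_add, finner_add_left, finner_sub_right, finner_sub_right, hsymm]
    ring
  have hgap := hmax T hTS
  rw [hexpand, hexpand, hZT] at hgap
  have hbound := finner_mul_le_opNorm Δ (S + T) (S - T)
  have hD2 : frobNorm (S - T) ^ 2 = 2 * (n * d) - 2 * finner S T := by
    rw [sq_frobNorm, finner_sub_left, finner_sub_right, finner_sub_right, finner_comm T S,
      hSS, hTT]
    ring
  have hsum2 : frobNorm (S + T) ^ 2 = 2 * (n * d) + 2 * finner S T := by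
    rw [sq_frobNorm, finner_add_left, finner_add_right, finner_add_right, finner_comm T S,
      hSS, hTT]
    ring
  have hratio : √((d : ℝ) / n) * n = √((n : ℝ) * d) := by
    rw [← Real.sqrt_sq hn0.le, ← Real.sqrt_mul (by positivity), Real.sqrt_sq hn0.le]
    congr 1
    field_simp
  have hsum_le : frobNorm (S + T) ≤ 2 * (√((d : ℝ) / n) * n) := by
    rw [hratio]
    refine abs_le_of_sq_le_sq' ?_ (by positivity) |>.2
    rw [mul_pow, Real.sq_sqrt (by positivity)]
    nlinarith [sq_nonneg (frobNorm (S - T))]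
  have hD0 := frobNorm_nonneg (S - T)
  have hΔ0 := opNorm_nonneg Δ
  refine (dF_le S hQ).trans ?_
  rw [← hT]
  have hkey : n * frobNorm (S - T) * frobNorm (S - T)
      ≤ n * (4 * √((d : ℝ) / n) * opNorm Δ) * frobNorm (S - T) := by
    have hmono : opNorm Δ * (frobNorm (S + T) * frobNorm (S - T))
        ≤ opNorm Δ * (2 * (√((d : ℝ) / n) * n) * frobNorm (S - T)) := by gcongr
    rw [hST] at hD2
    nlinarith
  rcases hD0.eq_or_lt with h0 | hpos
  · rw [← h0]
    positivity
  · exact le_of_mul_le_mul_left (le_of_mul_le_mul_right hkey hpos) hn0
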